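/- arXiv:1204.1075 — 7 statements merged into one kernel-verified Lean document; each statement's English description precedes it below -/
import Mathlib

section
/- Let (𝔤, 𝔥) be a matched pair of Lie algebras over a field k. Then the bracket [(a₁, y₁), (a₂, y₂)] = ([a₁, a₂] + Δ_{y₁}(a₂) − Δ_{y₂}(a₁), [y₁, y₂] + a₁·y₂ − a₂·y₁) defines a Lie algebra structure on the direct sum vector space 𝔤 ⊕ 𝔥 (it is bilinear, alternating, and satisfies the Jacobi identity), and 𝔤 ⊕ 0 and 0 ⊕ 𝔥 are Lie subalgebras with the original brackets of 𝔤 and 𝔥. -/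
/-- Given a matched pair of Lie algebras `(𝔤, 𝔥)` over a field `k`,
the bracket `[(a₁,y₁),(a₂,y₂)] = ([a₁,a₂] + Δ_{y₁}a₂ − Δ_{y₂}a₁, [y₁,y₂] + a₁·y₂ − a₂·y₁)`
defines a Lie algebra structure on `𝔤 ⊕ 𝔥` (bilinear, alternating, Jacobi) for which
`𝔤 ⊕ 0` and `0 ⊕ 𝔥` are Lie subalgebras with their original brackets. -/
theorem atiyah_stmt1 (k : Type*) [Field k]
    (g : Type*) [LieRing g] [LieAlgebra k g]
    (h : Type*) [LieRing h] [LieAlgebra k h]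
    (act : g →ₗ[k] h →ₗ[k] h) (Δ : h →ₗ[k] g →ₗ[k] g)
    (hact : ∀ (a₁ a₂ : g) (y : h), act ⁅a₁, a₂⁆ y = act a₁ (act a₂ y) - act a₂ (act a₁ y))
    (hΔ : ∀ (y₁ y₂ : h) (a : g), Δ ⁅y₁, y₂⁆ a = Δ y₁ (Δ y₂ a) - Δ y₂ (Δ y₁ a))
    (hc1 : ∀ (a : g) (y₁ y₂ : h),
      act a ⁅y₁, y₂⁆ = ⁅act a y₁, y₂⁆ + ⁅y₁, act a y₂⁆ + act (Δ y₂ a) y₁ - act (Δ y₁ a) y₂)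
    (hc2 : ∀ (y : h) (a₁ a₂ : g),
      Δ y ⁅a₁, a₂⁆ = ⁅Δ y a₁, a₂⁆ + ⁅a₁, Δ y a₂⁆ + Δ (act a₂ y) a₁ - Δ (act a₁ y) a₂) :
    ∀ br : (g × h) → (g × h) → (g × h),
      (∀ p₁ p₂ : g × h, br p₁ p₂ =
        (⁅p₁.1, p₂.1⁆ + Δ p₁.2 p₂.1 - Δ p₂.2 p₁.1,
         ⁅p₁.2, p₂.2⁆ + act p₁.1 p₂.2 - act p₂.1 p₁.2)) →
      -- bilinearity
      ((∀ (c : k) (p₁ p₂ p₃ : g × h), br (c • p₁ + p₂) p₃ = c • br p₁ p₃ + br p₂ p₃) ∧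
       (∀ (c : k) (p₁ p₂ p₃ : g × h), br p₁ (c • p₂ + p₃) = c • br p₁ p₂ + br p₁ p₃) ∧
       -- alternating
       (∀ p : g × h, br p p = 0) ∧
       -- Jacobi identity (Leibniz form)
       (∀ p₁ p₂ p₃ : g × h, br p₁ (br p₂ p₃) = br (br p₁ p₂) p₃ + br p₂ (br p₁ p₃)) ∧
       -- 𝔤 ⊕ 0 and 0 ⊕ 𝔥 are Lie subalgebras with the original brackets
       (∀ a₁ a₂ : g, br (a₁, 0) (a₂, 0) = (⁅a₁, a₂⁆, 0)) ∧
       (∀ y₁ y₂ : h, br (0, y₁) (0, y₂) = (0, ⁅y₁, y₂⁆))) := by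
  intro br hbr
  refine ⟨?_, ?_, ?_, ?_, ?_, ?_⟩
  · rintro c ⟨a₁, y₁⟩ ⟨a₂, y₂⟩ ⟨a₃, y₃⟩
    simp only [hbr, Prod.smul_mk, Prod.mk_add_mk, add_lie, smul_lie, map_add, map_smul,
      LinearMap.add_apply, LinearMap.smul_apply, Prod.mk.injEq]
    constructor <;> module
  · rintro c ⟨a₁, y₁⟩ ⟨a₂, y₂⟩ ⟨a₃, y₃⟩
    simp only [hbr, Prod.smul_mk, Prod.mk_add_mk, lie_add, lie_smul, map_add, map_smul,
      LinearMap.add_apply, LinearMap.smul_apply, Prod.mk.injEq]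
    constructor <;> module
  · rintro ⟨a, y⟩
    simp [hbr]
  · rintro ⟨a₁, y₁⟩ ⟨a₂, y₂⟩ ⟨a₃, y₃⟩
    simp only [hbr, Prod.mk_add_mk, Prod.mk.injEq, lie_add, lie_sub, add_lie, sub_lie, map_add,
      map_sub, LinearMap.add_apply, LinearMap.sub_apply, hact, hΔ, hc1, hc2]
    constructor
    · rw [leibniz_lie a₁ a₂ a₃, ← lie_skew a₂ (Δ y₃ a₁)]
      abel
    · rw [leibniz_lie y₁ y₂ y₃, ← lie_skew y₂ (act a₃ y₁)]
      abel
  · simp [hbr]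
  · simp [hbr]
end

section
/- Let (𝔡, 𝔤) be a Lie pair of Lie algebras with a fixed linear splitting (j, p), and let ∇ : 𝔡 → End(B) be an extension of the quotient 𝔤-action on B with Atiyah cocycle R^∇ and torsion β(b₁, b₂) = ∇_{j(b₁)}b₂ − ∇_{j(b₂)}b₁ − q([j(b₁), j(b₂)]). Then for all a ∈ 𝔤 and b₁, b₂ ∈ B: R^∇(a; b₁)(b₂) − R^∇(a; b₂)(b₁) = a·β(b₁, b₂) − β(a·b₁, b₂) − β(b₁, a·b₂). (In particular, the symmetrization defect of the Atiyah cocycle of B is a Chevalley–Eilenberg coboundary.) -/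
/-- The quotient action of a Lie subalgebra `𝔤` on `B = 𝔡 ⧸ 𝔤`, `a · q(l) = q ⁅a, l⁆`. -/
def qact {k : Type*} [Field k] {d : Type*} [LieRing d] [LieAlgebra k d]
    (g : LieSubalgebra k d) (a : g) :
    (d ⧸ g.toSubmodule) →ₗ[k] (d ⧸ g.toSubmodule) :=
  Submodule.mapQ g.toSubmodule g.toSubmodule (LieAlgebra.ad k d (a : d))
    (fun x hx => by
      rw [Submodule.mem_comap, LieAlgebra.ad_apply]
      exact g.lie_mem a.2 hx)

/-- The Atiyah cocycle `R^∇(a; b) = ∇_a∘∇_{j(b)} − ∇_{j(b)}∘∇_a − ∇_{[a, j(b)]}` of an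
extension `∇ : 𝔡 → End(B)`, computed at the representative `j(b)` of `b ∈ B = 𝔡/𝔤`. -/
def atiyahB {k : Type*} [Field k] {d : Type*} [LieRing d] [LieAlgebra k d]
    (g : LieSubalgebra k d)
    (nab : d →ₗ[k] Module.End k (d ⧸ g.toSubmodule))
    (jmap : (d ⧸ g.toSubmodule) →ₗ[k] d) (a : g) (b : d ⧸ g.toSubmodule) :
    Module.End k (d ⧸ g.toSubmodule) :=
  nab (a : d) ∘ₗ nab (jmap b) - nab (jmap b) ∘ₗ nab (a : d) - nab ⁅(a : d), jmap b⁆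

/-- The torsion `β(b₁, b₂) = ∇_{j(b₁)}b₂ − ∇_{j(b₂)}b₁ − q([j(b₁), j(b₂)])`. -/
def torsionB {k : Type*} [Field k] {d : Type*} [LieRing d] [LieAlgebra k d]
    (g : LieSubalgebra k d)
    (nab : d →ₗ[k] Module.End k (d ⧸ g.toSubmodule))
    (jmap : (d ⧸ g.toSubmodule) →ₗ[k] d) (b₁ b₂ : d ⧸ g.toSubmodule) :
    d ⧸ g.toSubmodule :=
  nab (jmap b₁) b₂ - nab (jmap b₂) b₁ - g.toSubmodule.mkQ ⁅jmap b₁, jmap b₂⁆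

/-- The quotient action is computed on any representative: `a · q(l) = q ⁅a, l⁆`. -/
theorem qact_mkQ {k : Type*} [Field k] {d : Type*} [LieRing d] [LieAlgebra k d]
    (g : LieSubalgebra k d) (a : g) (l : d) :
    qact g a (g.toSubmodule.mkQ l) = g.toSubmodule.mkQ ⁅(a : d), l⁆ := rfl

/-- For a splitting, `∇_{[a, j(b)]} c = ∇_{j(a·b)} c + q ⁅[a, j(b)] - j(a·b), j(c)⁆`. -/
theorem nab_lie_apply {k : Type*} [Field k] {d : Type*} [LieRing d] [LieAlgebra k d]
    (g : LieSubalgebra k d)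
    (jmap : (d ⧸ g.toSubmodule) →ₗ[k] d)
    (hj : ∀ b : d ⧸ g.toSubmodule, g.toSubmodule.mkQ (jmap b) = b)
    (nab : d →ₗ[k] Module.End k (d ⧸ g.toSubmodule))
    (hext : ∀ (a : g) (b : d ⧸ g.toSubmodule), nab (a : d) b = qact g a b)
    (a : g) (b c : d ⧸ g.toSubmodule) :
    nab ⁅(a : d), jmap b⁆ c = nab (jmap (qact g a b)) c
      + g.toSubmodule.mkQ ⁅⁅(a : d), jmap b⁆, jmap c⁆
      - g.toSubmodule.mkQ ⁅jmap (qact g a b), jmap c⁆ := by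
  have hmem : ⁅(a : d), jmap b⁆ - jmap (qact g a b) ∈ g.toSubmodule := by
    refine (Submodule.Quotient.mk_eq_zero g.toSubmodule).mp ?_
    rw [← Submodule.mkQ_apply, map_sub, hj, ← qact_mkQ, hj, sub_self]
  have h := hext ⟨_, hmem⟩ c
  conv_rhs at h => rw [← hj c, qact_mkQ]
  simp only [sub_lie, map_sub, LinearMap.sub_apply] at h
  rw [add_sub_assoc, ← h]
  abel

/-- For a Lie pair `(𝔡, 𝔤)` with a linear splitting `(j, p)` and an
extension `∇ : 𝔡 → End(B)` of the quotient `𝔤`-action on `B` with torsion `β`,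
`R^∇(a; b₁)(b₂) − R^∇(a; b₂)(b₁) = a·β(b₁, b₂) − β(a·b₁, b₂) − β(b₁, a·b₂)`. -/
theorem atiyah_stmt11 (k : Type*) [Field k] (d : Type*) [LieRing d] [LieAlgebra k d]
    (g : LieSubalgebra k d)
    (jmap : (d ⧸ g.toSubmodule) →ₗ[k] d) (pmap : d →ₗ[k] g)
    (hj : ∀ b : d ⧸ g.toSubmodule, g.toSubmodule.mkQ (jmap b) = b)
    (hp : ∀ a : g, pmap (a : d) = a)
    (hjp : ∀ l : d, jmap (g.toSubmodule.mkQ l) + ((pmap l : g) : d) = l)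
    (nab : d →ₗ[k] Module.End k (d ⧸ g.toSubmodule))
    (hext : ∀ (a : g) (b : d ⧸ g.toSubmodule), nab (a : d) b = qact g a b) :
    ∀ (a : g) (b₁ b₂ : d ⧸ g.toSubmodule),
      atiyahB g nab jmap a b₁ b₂ - atiyahB g nab jmap a b₂ b₁
        = qact g a (torsionB g nab jmap b₁ b₂)
          - torsionB g nab jmap (qact g a b₁) b₂
          - torsionB g nab jmap b₁ (qact g a b₂) := by
  intro a b₁ b₂
  have hact : qact g a (g.toSubmodule.mkQ ⁅jmap b₁, jmap b₂⁆)
      = g.toSubmodule.mkQ ⁅⁅(a : d), jmap b₁⁆, jmap b₂⁆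
        - g.toSubmodule.mkQ ⁅⁅(a : d), jmap b₂⁆, jmap b₁⁆ := by
    rw [qact_mkQ, leibniz_lie, ← lie_skew (jmap b₁), map_add, map_neg, sub_eq_add_neg]
  have hskew : g.toSubmodule.mkQ ⁅jmap b₁, jmap (qact g a b₂)⁆
      = -g.toSubmodule.mkQ ⁅jmap (qact g a b₂), jmap b₁⁆ := by
    rw [← lie_skew, map_neg]
  simp only [atiyahB, torsionB, LinearMap.sub_apply, LinearMap.comp_apply, map_sub, hext,
    nab_lie_apply g jmap hj nab hext, hact, hskew]
  abel
end

section
/- Let (𝔡, 𝔤) be a Lie pair of Lie algebras with a fixed linear splitting (j, p), and set δ_b(a) = p([j(b), a]) ∈ 𝔤 for b ∈ B, a ∈ 𝔤. Then for all a₁, a₂ ∈ 𝔤 and b ∈ B: [δ_b(a₁), a₂] + [a₁, δ_b(a₂)] − δ_b([a₁, a₂]) = δ_{a₁·b}(a₂) − δ_{a₂·b}(a₁). -/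
/-- The lift of `a · b` along a splitting differs from `⁅a, j b⁆` by its `𝔤`-component. -/
theorem splitting_qact {k : Type*} [Field k] {d : Type*} [LieRing d] [LieAlgebra k d]
    (g : LieSubalgebra k d)
    (jmap : (d ⧸ g.toSubmodule) →ₗ[k] d) (pmap : d →ₗ[k] g)
    (hj : ∀ b : d ⧸ g.toSubmodule, g.toSubmodule.mkQ (jmap b) = b)
    (hjp : ∀ l : d, jmap (g.toSubmodule.mkQ l) + ((pmap l : g) : d) = l)
    (a : g) (b : d ⧸ g.toSubmodule) :
    jmap (qact g a b) = ⁅(a : d), jmap b⁆ + ((pmap ⁅jmap b, (a : d)⁆ : g) : d) := by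
  have hq : qact g a b = g.toSubmodule.mkQ ⁅(a : d), jmap b⁆ := by
    conv_lhs => rw [← hj b]
    rfl
  rw [hq, eq_sub_of_add_eq (hjp ⁅(a : d), jmap b⁆), ← lie_skew (jmap b) (a : d), map_neg]
  simp [sub_eq_add_neg]

/-- For a Lie pair `(𝔡, 𝔤)` with a linear splitting `(j, p)` and
`δ_b(a) = p([j(b), a])`, one has
`[δ_b(a₁), a₂] + [a₁, δ_b(a₂)] − δ_b([a₁, a₂]) = δ_{a₁·b}(a₂) − δ_{a₂·b}(a₁)`. -/
theorem atiyah_stmt12 (k : Type*) [Field k] (d : Type*) [LieRing d] [LieAlgebra k d]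
    (g : LieSubalgebra k d)
    (jmap : (d ⧸ g.toSubmodule) →ₗ[k] d) (pmap : d →ₗ[k] g)
    (hj : ∀ b : d ⧸ g.toSubmodule, g.toSubmodule.mkQ (jmap b) = b)
    (hp : ∀ a : g, pmap (a : d) = a)
    (hjp : ∀ l : d, jmap (g.toSubmodule.mkQ l) + ((pmap l : g) : d) = l) :
    ∀ (a₁ a₂ : g) (b : d ⧸ g.toSubmodule),
      ⁅pmap ⁅jmap b, (a₁ : d)⁆, a₂⁆ + ⁅a₁, pmap ⁅jmap b, (a₂ : d)⁆⁆
          - pmap ⁅jmap b, ((⁅a₁, a₂⁆ : g) : d)⁆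
        = pmap ⁅jmap (qact g a₁ b), (a₂ : d)⁆ - pmap ⁅jmap (qact g a₂ b), (a₁ : d)⁆ := by
  intro a₁ a₂ b
  have hpl (x y : g) : pmap ⁅(x : d), (y : d)⁆ = ⁅x, y⁆ := by
    rw [← LieSubalgebra.coe_bracket, hp]
  have jac : ⁅jmap b, ⁅(a₁ : d), (a₂ : d)⁆⁆
      = ⁅⁅(a₂ : d), jmap b⁆, (a₁ : d)⁆ - ⁅⁅(a₁ : d), jmap b⁆, (a₂ : d)⁆ := by
    rw [leibniz_lie, ← lie_skew (a₁ : d) ⁅jmap b, (a₂ : d)⁆, ← lie_skew (jmap b) (a₁ : d),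
      ← lie_skew (jmap b) (a₂ : d), neg_lie, neg_lie]
    abel
  rw [splitting_qact g jmap pmap hj hjp, splitting_qact g jmap pmap hj hjp,
    LieSubalgebra.coe_bracket, jac, add_lie, add_lie, map_add, map_add, map_sub, hpl, hpl,
    ← lie_skew a₁]
  abel
end

section
/- Let (𝔡, 𝔤) be a Lie pair of Lie algebras with a fixed linear splitting (j, p); set δ_b(a) = p([j(b), a]) ∈ 𝔤 and α(b₁, b₂) = p([j(b₁), j(b₂)]) ∈ 𝔤. Then for all a ∈ 𝔤 and b₀, b₁ ∈ B: [α(b₀, b₁), a] + α(a·b₀, b₁) + α(b₀, a·b₁) = δ_{b₀}(δ_{b₁}(a)) − δ_{b₁}(δ_{b₀}(a)) − δ_{q([j(b₀), j(b₁)])}(a). -/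
/-- A linear splitting `(j, p)` lifts the quotient action: `j(a · b) = p([j(b), a]) - [j(b), a]`. -/
theorem lift_qact {k : Type*} [Field k] {d : Type*} [LieRing d] [LieAlgebra k d]
    (g : LieSubalgebra k d)
    (jmap : (d ⧸ g.toSubmodule) →ₗ[k] d) (pmap : d →ₗ[k] g)
    (hj : ∀ b : d ⧸ g.toSubmodule, g.toSubmodule.mkQ (jmap b) = b)
    (hjp : ∀ l : d, jmap (g.toSubmodule.mkQ l) + ((pmap l : g) : d) = l)
    (a : g) (b : d ⧸ g.toSubmodule) :
    jmap (qact g a b) = ((pmap ⁅jmap b, (a : d)⁆ : g) : d) - ⁅jmap b, (a : d)⁆ := by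
  have hq : qact g a b = g.toSubmodule.mkQ ⁅(a : d), jmap b⁆ := by
    conv_lhs => rw [← hj b]
    rfl
  rw [hq, ← lie_skew (a : d) (jmap b), map_neg, map_neg,
    eq_sub_of_add_eq (hjp ⁅jmap b, (a : d)⁆), neg_sub]

/-- For a Lie pair `(𝔡, 𝔤)` with a linear splitting `(j, p)`, setting
`δ_b(a) = p([j(b), a])` and `α(b₁, b₂) = p([j(b₁), j(b₂)])`, one has
`[α(b₀,b₁), a] + α(a·b₀, b₁) + α(b₀, a·b₁)
  = δ_{b₀}(δ_{b₁}(a)) − δ_{b₁}(δ_{b₀}(a)) − δ_{q([j(b₀), j(b₁)])}(a)`. -/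
theorem atiyah_stmt13 (k : Type*) [Field k] (d : Type*) [LieRing d] [LieAlgebra k d]
    (g : LieSubalgebra k d)
    (jmap : (d ⧸ g.toSubmodule) →ₗ[k] d) (pmap : d →ₗ[k] g)
    (hj : ∀ b : d ⧸ g.toSubmodule, g.toSubmodule.mkQ (jmap b) = b)
    (hp : ∀ a : g, pmap (a : d) = a)
    (hjp : ∀ l : d, jmap (g.toSubmodule.mkQ l) + ((pmap l : g) : d) = l) :
    ∀ (a : g) (b₀ b₁ : d ⧸ g.toSubmodule),
      ⁅pmap ⁅jmap b₀, jmap b₁⁆, a⁆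
          + pmap ⁅jmap (qact g a b₀), jmap b₁⁆
          + pmap ⁅jmap b₀, jmap (qact g a b₁)⁆
        = pmap ⁅jmap b₀, ((pmap ⁅jmap b₁, (a : d)⁆ : g) : d)⁆
          - pmap ⁅jmap b₁, ((pmap ⁅jmap b₀, (a : d)⁆ : g) : d)⁆
          - pmap ⁅jmap (g.toSubmodule.mkQ ⁅jmap b₀, jmap b₁⁆), (a : d)⁆ := by
  intro a b₀ b₁
  have hbr : ⁅pmap ⁅jmap b₀, jmap b₁⁆, a⁆
      = pmap ⁅((pmap ⁅jmap b₀, jmap b₁⁆ : g) : d), (a : d)⁆ := by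
    rw [← LieSubalgebra.coe_bracket, hp]
  rw [hbr, lift_qact g jmap pmap hj hjp, lift_qact g jmap pmap hj hjp,
    eq_sub_of_add_eq' (hjp ⁅jmap b₀, jmap b₁⁆)]
  simp only [← map_add, ← map_sub]
  congr 1
  simp only [sub_lie, lie_sub]
  rw [lie_lie (jmap b₀) (jmap b₁) (a : d),
    ← lie_skew ((pmap ⁅jmap b₀, (a : d)⁆ : g) : d) (jmap b₁),
    ← lie_skew ⁅jmap b₀, (a : d)⁆ (jmap b₁)]
  abel
end

section
/- Let (𝔡, 𝔤) be a Lie pair of Lie algebras with a fixed linear splitting (j, p), ∇ : 𝔡 → End(B) an extension of the quotient 𝔤-action on B, and R_n the associated higher Atiyah maps; let α(b₁, b₂) = p([j(b₁), j(b₂)]) ∈ 𝔤, β(b₁, b₂) = ∇_{j(b₁)}b₂ − ∇_{j(b₂)}b₁ − q([j(b₁), j(b₂)]) ∈ B, and Ω(b₁, b₂) = ∇_{j(b₁)}∘∇_{j(b₂)} − ∇_{j(b₂)}∘∇_{j(b₁)} − ∇_{[j(b₁), j(b₂)]} ∈ End(B). Then for every n ≥ 3 and all a ∈ 𝔤, b₀,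 b₁, …, b_n ∈ B: R_{n+1}(b₀, b₁, b₂, …, b_n)(a) − R_{n+1}(b₁, b₀, b₂, …, b_n)(a) = Ω(b₀, b₁)(R_{n−1}(b₂, …, b_n)(a)) − Σ_{j=2}^{n} R_{n−1}(b₂, …, Ω(b₀, b₁)(b_j), …, b_n)(a) + α(b₀, b₁)·(R_{n−1}(b₂, …, b_n)(a)) − Σ_{j=2}^{n} R_{n−1}(b₂, …, α(b₀, b₁)·b_j, …, b_n)(a) − R_{n−1}(b₂, …, b_n)([α(b₀, b₁), a] + α(a·b₀, b₁) + α(b₀, a·b₁)) + R_n(β(b₀, b₁), b₂, …, b_n)(a). -/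
/-- The higher Atiyah maps `R_n : Bⁿ → Hom(𝔤, B)` of a Lie pair with splitting `(j, p)`
and extension `∇`. -/
def hR {k : Type*} [Field k] {d : Type*} [LieRing d] [LieAlgebra k d]
    (g : LieSubalgebra k d)
    (nab : d →ₗ[k] Module.End k (d ⧸ g.toSubmodule))
    (jmap : (d ⧸ g.toSubmodule) →ₗ[k] d) (pmap : d →ₗ[k] g) :
    (n : ℕ) → (Fin n → (d ⧸ g.toSubmodule)) → g → (d ⧸ g.toSubmodule)
  | 0, _, _ => 0
  | 1, _, _ => 0
  | 2, b, a =>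
      nab (a : d) (nab (jmap (b 0)) (b 1)) - nab (jmap (b 0)) (nab (a : d) (b 1))
        - nab ⁅(a : d), jmap (b 0)⁆ (b 1)
  | (n+3), b, a =>
      (∑ i : Fin (n+2), hR g nab jmap pmap (n+2)
          (Function.update (fun m : Fin (n+2) => b m.succ) i (nab (jmap (b 0)) (b i.succ))) a)
      + hR g nab jmap pmap (n+2) (fun m => b m.succ) (pmap ⁅jmap (b 0), (a : d)⁆)
      - nab (jmap (b 0)) (hR g nab jmap pmap (n+2) (fun m => b m.succ) a)

/-- The curvature `Ω(b₁, b₂) = ∇_{j(b₁)}∘∇_{j(b₂)} − ∇_{j(b₂)}∘∇_{j(b₁)} − ∇_{[j(b₁), j(b₂)]}`. -/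
def omegaB {k : Type*} [Field k] {d : Type*} [LieRing d] [LieAlgebra k d]
    (g : LieSubalgebra k d)
    (nab : d →ₗ[k] Module.End k (d ⧸ g.toSubmodule))
    (jmap : (d ⧸ g.toSubmodule) →ₗ[k] d) (b₁ b₂ : d ⧸ g.toSubmodule) :
    Module.End k (d ⧸ g.toSubmodule) :=
  nab (jmap b₁) ∘ₗ nab (jmap b₂) - nab (jmap b₂) ∘ₗ nab (jmap b₁) - nab ⁅jmap b₁, jmap b₂⁆

section LieDerivative

variable {k ι M A : Type*} [Field k] [DecidableEq ι]
  [AddCommGroup M] [Module k M] [AddCommGroup A] [Module k A]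

theorem update_id_apply_eq_update (X : Module.End k M) (b : ι → M) (i : ι) :
    (fun j => Function.update (fun _ => LinearMap.id) i X j (b j))
      = Function.update b i (X (b i)) := by
  ext j
  rcases eq_or_ne j i with rfl | hji <;> simp [*]

variable [Fintype ι]

/-- The action of a pair of endomorphisms `(X, δ)` of `M` and `A` on the multilinear maps
`Mⁿ → Hom(A, M)`, by the Leibniz rule (and with `X` acting on the values with a minus sign). -/
def leibnizAction (F : MultilinearMap k (fun _ : ι => M) (A →ₗ[k] M)) :
    Module.End k M × Module.End k A →ₗ[k] MultilinearMap k (fun _ : ι => M) (A →ₗ[k] M) where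
  toFun P := ∑ i, F.compLinearMap (Function.update (fun _ => LinearMap.id) i P.1)
    + (LinearMap.lcomp k M P.2).compMultilinearMap F
    - (LinearMap.llcomp k A M M P.1).compMultilinearMap F
  map_add' P Q := by
    ext b a
    simp only [LinearMap.llcomp_apply', add_apply, sub_apply, sum_apply,
      MultilinearMap.compLinearMap_apply, LinearMap.compMultilinearMap_apply,
      update_id_apply_eq_update, LinearMap.add_apply,
      LinearMap.sub_apply, LinearMap.lcomp_apply, LinearMap.comp_apply, Prod.fst_add,
      Prod.snd_add, map_add, MultilinearMap.map_update_add, Finset.sum_add_distrib]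
    abel
  map_smul' c P := by
    ext b a
    simp only [LinearMap.llcomp_apply', add_apply, sub_apply, sum_apply,
      MultilinearMap.compLinearMap_apply, LinearMap.compMultilinearMap_apply,
      update_id_apply_eq_update, LinearMap.add_apply,
      smul_apply, RingHom.id_apply, LinearMap.smul_apply, ← Finset.smul_sum,
      LinearMap.sub_apply, LinearMap.lcomp_apply, LinearMap.comp_apply, Prod.smul_fst,
      Prod.smul_snd, map_smul, MultilinearMap.map_update_smul, smul_add, smul_sub]

theorem leibnizAction_apply (F : MultilinearMap k (fun _ : ι => M) (A →ₗ[k] M))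
    (P : Module.End k M × Module.End k A) (b : ι → M) (a : A) :
    leibnizAction F P b a
      = ∑ i, F (Function.update b i (P.1 (b i))) a + F b (P.2 a) - P.1 (F b a) := by
  simp [leibnizAction, update_id_apply_eq_update]

theorem leibnizAction_commutator (F : MultilinearMap k (fun _ : ι => M) (A →ₗ[k] M))
    (P Q : Module.End k M × Module.End k A) :
    leibnizAction (leibnizAction F Q) P - leibnizAction (leibnizAction F P) Q
      = leibnizAction F (Q * P - P * Q) := by
  ext b a
  have key (X Y : Module.End k M) :
      ∑ i, ∑ j, F (Function.update (Function.update b i (X (b i))) j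
          (Y (Function.update b i (X (b i)) j))) a
        - ∑ i, F (Function.update b i (Y (X (b i)))) a
      = ∑ i, ∑ j, if j = i then 0
          else F (Function.update (Function.update b i (X (b i))) j (Y (b j))) a := by
    rw [← Finset.sum_sub_distrib]
    refine Finset.sum_congr rfl fun i _ => ?_
    simp only [← Finset.sum_erase_add _ _ (Finset.mem_univ i)]
    rw [sub_eq_iff_eq_add]
    simp only [Function.update_self, Function.update_idem, if_true, add_zero]
    congr 1
    refine Finset.sum_congr rfl fun j hj => ?_
    rw [if_neg (Finset.ne_of_mem_erase hj), Function.update_of_ne (Finset.ne_of_mem_erase hj)]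
  have swap (X Y : Module.End k M) :
      (∑ i, ∑ j, if j = i then 0
          else F (Function.update (Function.update b i (X (b i))) j (Y (b j))) a)
      = ∑ i, ∑ j, if j = i then 0
          else F (Function.update (Function.update b i (Y (b i))) j (X (b j))) a := by
    rw [Finset.sum_comm]
    refine Finset.sum_congr rfl fun i _ => Finset.sum_congr rfl fun j _ => ?_
    by_cases hij : j = i
    · simp [hij]
    · rw [if_neg hij, if_neg (Ne.symm hij), Function.update_comm (Ne.symm hij)]
  have h := (key P.1 Q.1).trans ((swap P.1 Q.1).trans (key Q.1 P.1).symm)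
  simp only [sub_apply, LinearMap.sub_apply, leibnizAction_apply,
    Prod.fst_mul, Prod.snd_mul, Module.End.mul_apply, Finset.sum_add_distrib, Finset.sum_sub_distrib,
    map_add, map_sub, map_sum]
  rw [sub_eq_sub_iff_add_eq_add] at h
  rw [← sub_eq_zero] at h ⊢
  rw [← h]
  abel

end LieDerivative

section Atiyah

variable {k : Type*} [Field k] {d : Type*} [LieRing d] [LieAlgebra k d]
  (g : LieSubalgebra k d) (nab : d →ₗ[k] Module.End k (d ⧸ g.toSubmodule))
  (jmap : (d ⧸ g.toSubmodule) →ₗ[k] d) (pmap : d →ₗ[k] g)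

/-- The pair of endomorphisms `(∇_{j(b)}, δ_b)` of `B` and `𝔤`, as a linear function of `b`. -/
def splitPair : (d ⧸ g.toSubmodule) →ₗ[k] Module.End k (d ⧸ g.toSubmodule) × Module.End k g :=
  (nab ∘ₗ jmap).prod
    { toFun := fun b =>
        pmap ∘ₗ (LieAlgebra.ad k d (jmap b) : Module.End k d) ∘ₗ g.toSubmodule.subtype
      map_add' := fun x y => by ext; simp
      map_smul' := fun c x => by ext; simp }

theorem splitPair_fst (b : d ⧸ g.toSubmodule) :
    (splitPair g nab jmap pmap b).1 = nab (jmap b) := rfl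

theorem splitPair_snd (b : d ⧸ g.toSubmodule) (a : g) :
    (splitPair g nab jmap pmap b).2 a = pmap ⁅jmap b, (a : d)⁆ := rfl

theorem hR_succ (n : ℕ) (b : Fin (n + 3) → (d ⧸ g.toSubmodule)) (a : g) :
    hR g nab jmap pmap (n + 3) b a =
      (∑ i : Fin (n+2), hR g nab jmap pmap (n+2)
          (Function.update (fun m : Fin (n+2) => b m.succ) i (nab (jmap (b 0)) (b i.succ))) a)
      + hR g nab jmap pmap (n+2) (fun m => b m.succ) (pmap ⁅jmap (b 0), (a : d)⁆)
      - nab (jmap (b 0)) (hR g nab jmap pmap (n+2) (fun m => b m.succ) a) := by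
  rw [hR]

variable {g nab jmap pmap}

theorem hR_succ_eq_leibnizAction {n : ℕ}
    {F : MultilinearMap k (fun _ : Fin (n + 2) => d ⧸ g.toSubmodule)
      (g →ₗ[k] (d ⧸ g.toSubmodule))}
    (hF : ∀ b a, F b a = hR g nab jmap pmap (n + 2) b a)
    (b : Fin (n + 3) → (d ⧸ g.toSubmodule)) (a : g) :
    hR g nab jmap pmap (n + 3) b a
      = leibnizAction F (splitPair g nab jmap pmap (b 0)) (fun i => b i.succ) a := by
  simp only [hR_succ, leibnizAction_apply, splitPair_fst, splitPair_snd, hF]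

variable (g nab jmap pmap)

theorem exists_multilinearMap_eq_hR (n : ℕ) :
    ∃ F : MultilinearMap k (fun _ : Fin (n + 2) => d ⧸ g.toSubmodule)
      (g →ₗ[k] (d ⧸ g.toSubmodule)),
      ∀ b a, F b a = hR g nab jmap pmap (n + 2) b a := by
  induction n with
  | zero =>
    refine ⟨MultilinearMap.mk' (fun b =>
      { toFun := fun a => hR g nab jmap pmap 2 b a
        map_add' := fun x y => ?_
        map_smul' := fun c x => ?_ }) (fun b i x y => ?_) (fun b i c x => ?_), fun _ _ => rfl⟩
    · simp [hR]
      abel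
    · simp [hR, smul_sub]
    · ext a
      fin_cases i <;>
      · simp [hR]
        abel
    · ext a
      fin_cases i <;> simp [hR, smul_sub]
  | succ n ih =>
    obtain ⟨F, hF⟩ := ih
    refine ⟨LinearMap.uncurryLeft (M := fun _ : Fin (n + 3) => d ⧸ g.toSubmodule)
      (leibnizAction F ∘ₗ splitPair g nab jmap pmap), fun b a => ?_⟩
    exact (hR_succ_eq_leibnizAction hF b a).symm

variable {g nab jmap pmap}

theorem hR_succ_succ_eq_leibnizAction {n : ℕ}
    {F : MultilinearMap k (fun _ : Fin (n + 2) => d ⧸ g.toSubmodule)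
      (g →ₗ[k] (d ⧸ g.toSubmodule))}
    (hF : ∀ b a, F b a = hR g nab jmap pmap (n + 2) b a)
    (b : Fin (n + 4) → (d ⧸ g.toSubmodule)) (a : g) :
    hR g nab jmap pmap (n + 4) b a
      = leibnizAction F (splitPair g nab jmap pmap (nab (jmap (b 0)) (b 1)))
          (fun i => b i.succ.succ) a
        + leibnizAction (leibnizAction F (splitPair g nab jmap pmap (b 1)))
          (splitPair g nab jmap pmap (b 0)) (fun i => b i.succ.succ) a := by
  rw [hR_succ, Fin.sum_univ_succ, leibnizAction_apply _ (splitPair g nab jmap pmap (b 0))]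
  have hu (i : Fin (n + 2)) (x : d ⧸ g.toSubmodule) :
      (fun l : Fin (n + 2) =>
        Function.update (fun m : Fin (n + 3) => b m.succ) i.succ x l.succ)
        = Function.update (fun l => b l.succ.succ) i x := by
    ext l
    simp [Function.update_apply]
  simp only [hR_succ_eq_leibnizAction hF, splitPair_fst, splitPair_snd, hu,
    Function.update_self, Function.update_of_ne (Fin.succ_ne_zero _),
    Function.update_of_ne (Fin.succ_ne_zero _).symm, Fin.succ_zero_eq_one]
  abel

theorem pmap_lie_commutator
    (hj : ∀ b : d ⧸ g.toSubmodule, g.toSubmodule.mkQ (jmap b) = b)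
    (hp : ∀ a : g, pmap (a : d) = a)
    (hjp : ∀ l : d, jmap (g.toSubmodule.mkQ l) + ((pmap l : g) : d) = l)
    (x y : d ⧸ g.toSubmodule) (a : g) :
    pmap ⁅jmap x, ((pmap ⁅jmap y, (a : d)⁆ : g) : d)⁆
      - pmap ⁅jmap y, ((pmap ⁅jmap x, (a : d)⁆ : g) : d)⁆
      - pmap ⁅jmap (g.toSubmodule.mkQ ⁅jmap x, jmap y⁆), (a : d)⁆
      = ⁅pmap ⁅jmap x, jmap y⁆, a⁆ + pmap ⁅jmap (qact g a x), jmap y⁆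
        + pmap ⁅jmap x, jmap (qact g a y)⁆ := by
  have hc (z : d ⧸ g.toSubmodule) :
      ((pmap ⁅jmap z, (a : d)⁆ : g) : d) = ⁅jmap z, (a : d)⁆ + jmap (qact g a z) := by
    have hq : qact g a z = g.toSubmodule.mkQ ⁅(a : d), jmap z⁆ := by
      conv_lhs => rw [← hj z]
      rfl
    rw [hq, ← lie_skew (a : d) (jmap z), map_neg, map_neg, ← sub_eq_add_neg]
    exact eq_sub_of_add_eq' (hjp _)
  have hb : pmap ⁅((pmap ⁅jmap x, jmap y⁆ : g) : d), (a : d)⁆ = ⁅pmap ⁅jmap x, jmap y⁆, a⁆ :=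
    hp ⁅pmap ⁅jmap x, jmap y⁆, a⁆
  rw [hc, hc, eq_sub_of_add_eq (hjp ⁅jmap x, jmap y⁆), ← hb, sub_lie, lie_lie, lie_add, lie_add,
    ← lie_skew (jmap (qact g a x)) (jmap y)]
  simp only [map_add, map_sub, map_neg]
  abel

end Atiyah

/-- For every `n ≥ 3` (written `n = m + 3`) and all
`a ∈ 𝔤`, `b₀, …, b_n ∈ B` (written `b : Fin (m+4) → B`):
`R_{n+1}(b₀,b₁,b₂,…,b_n)(a) − R_{n+1}(b₁,b₀,b₂,…,b_n)(a)
 = Ω(b₀,b₁)(R_{n−1}(b₂,…,b_n)(a)) − Σ_j R_{n−1}(b₂,…,Ω(b₀,b₁)(b_j),…,b_n)(a)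
   + α(b₀,b₁)·(R_{n−1}(b₂,…,b_n)(a)) − Σ_j R_{n−1}(b₂,…,α(b₀,b₁)·b_j,…,b_n)(a)
   − R_{n−1}(b₂,…,b_n)([α(b₀,b₁),a] + α(a·b₀,b₁) + α(b₀,a·b₁))
   + R_n(β(b₀,b₁),b₂,…,b_n)(a)`,
where `α(b₁,b₂) = p([j(b₁), j(b₂)])`. -/
theorem atiyah_stmt15 (k : Type*) [Field k] (d : Type*) [LieRing d] [LieAlgebra k d]
    (g : LieSubalgebra k d)
    (jmap : (d ⧸ g.toSubmodule) →ₗ[k] d) (pmap : d →ₗ[k] g)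
    (hj : ∀ b : d ⧸ g.toSubmodule, g.toSubmodule.mkQ (jmap b) = b)
    (hp : ∀ a : g, pmap (a : d) = a)
    (hjp : ∀ l : d, jmap (g.toSubmodule.mkQ l) + ((pmap l : g) : d) = l)
    (nab : d →ₗ[k] Module.End k (d ⧸ g.toSubmodule))
    (hext : ∀ (a : g) (b : d ⧸ g.toSubmodule), nab (a : d) b = qact g a b) :
    ∀ (m : ℕ) (a : g) (b : Fin (m + 4) → (d ⧸ g.toSubmodule)),
      hR g nab jmap pmap (m + 4) b a
          - hR g nab jmap pmap (m + 4) (fun i => b (Equiv.swap 0 1 i)) a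
        = omegaB g nab jmap (b 0) (b 1)
            (hR g nab jmap pmap (m + 2) (fun i : Fin (m + 2) => b i.succ.succ) a)
          - (∑ i : Fin (m + 2), hR g nab jmap pmap (m + 2)
              (Function.update (fun i : Fin (m + 2) => b i.succ.succ) i
                (omegaB g nab jmap (b 0) (b 1) (b i.succ.succ))) a)
          + qact g (pmap ⁅jmap (b 0), jmap (b 1)⁆)
              (hR g nab jmap pmap (m + 2) (fun i : Fin (m + 2) => b i.succ.succ) a)
          - (∑ i : Fin (m + 2), hR g nab jmap pmap (m + 2)
              (Function.update (fun i : Fin (m + 2) => b i.succ.succ) i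
                (qact g (pmap ⁅jmap (b 0), jmap (b 1)⁆) (b i.succ.succ))) a)
          - hR g nab jmap pmap (m + 2) (fun i : Fin (m + 2) => b i.succ.succ)
              (⁅pmap ⁅jmap (b 0), jmap (b 1)⁆, a⁆
                + pmap ⁅jmap (qact g a (b 0)), jmap (b 1)⁆
                + pmap ⁅jmap (b 0), jmap (qact g a (b 1))⁆)
          + hR g nab jmap pmap (m + 3)
              (Fin.cons (torsionB g nab jmap (b 0) (b 1))
                (fun i : Fin (m + 2) => b i.succ.succ)) a := by
  intro m a b
  obtain ⟨F, hF⟩ := exists_multilinearMap_eq_hR g nab jmap pmap m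
  have hs (i : Fin (m + 2)) : Equiv.swap (0 : Fin (m + 4)) 1 i.succ.succ = i.succ.succ :=
    Equiv.swap_apply_of_ne_of_ne (Fin.succ_ne_zero _)
      fun h => Fin.succ_ne_zero i (Fin.succ_injective _ h)
  have hcomm := congrArg (fun G => G (fun i => b i.succ.succ) a) (leibnizAction_commutator F
    (splitPair g nab jmap pmap (b 0)) (splitPair g nab jmap pmap (b 1)))
  have htors : leibnizAction F (splitPair g nab jmap pmap (torsionB g nab jmap (b 0) (b 1)))
      = leibnizAction F (splitPair g nab jmap pmap (nab (jmap (b 0)) (b 1)))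
        - leibnizAction F (splitPair g nab jmap pmap (nab (jmap (b 1)) (b 0)))
        - leibnizAction F (splitPair g nab jmap pmap
          (g.toSubmodule.mkQ ⁅jmap (b 0), jmap (b 1)⁆)) := by
    simp only [torsionB, map_sub]
  set c := g.toSubmodule.mkQ ⁅jmap (b 0), jmap (b 1)⁆
  set α := pmap ⁅jmap (b 0), jmap (b 1)⁆
  set P := splitPair g nab jmap pmap (b 0) with hP
  set Q := splitPair g nab jmap pmap (b 1) with hQ
  have hcurv : (splitPair g nab jmap pmap c + (Q * P - P * Q)).1
      = -(omegaB g nab jmap (b 0) (b 1) + qact g α) := by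
    have hα' : nab α = nab ⁅jmap (b 0), jmap (b 1)⁆ - nab (jmap c) := by
      rw [← map_sub, ← eq_sub_of_add_eq' (hjp _)]
    have hq : qact g α = nab α := LinearMap.ext fun x => (hext α x).symm
    rw [hq, hα']
    simp only [omegaB, Prod.fst_add, Prod.fst_sub, Prod.fst_mul, P, Q, splitPair_fst,
      Module.End.mul_eq_comp]
    abel
  have hbracket : (splitPair g nab jmap pmap c + (Q * P - P * Q)).2 a
      = -(⁅α, a⁆ + pmap ⁅jmap (qact g a (b 0)), jmap (b 1)⁆
          + pmap ⁅jmap (b 0), jmap (qact g a (b 1))⁆) := by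
    rw [← pmap_lie_commutator hj hp hjp]
    simp only [Prod.snd_add, Prod.snd_sub, Prod.snd_mul, LinearMap.add_apply, LinearMap.sub_apply,
      Module.End.mul_apply, P, Q, splitPair_snd]
    abel
  have hmain := leibnizAction_apply F (splitPair g nab jmap pmap c + (Q * P - P * Q))
    (fun i => b i.succ.succ) a
  rw [hcurv, hbracket, map_add] at hmain
  simp only [hR_succ_succ_eq_leibnizAction hF, hR_succ_eq_leibnizAction hF, hs,
    Equiv.swap_apply_left, Equiv.swap_apply_right, Fin.cons_zero, Fin.cons_succ, htors, ← hF,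
    ← hP, ← hQ]
  simp only [sub_apply, add_apply, LinearMap.sub_apply, LinearMap.add_apply,
    LinearMap.neg_apply, MultilinearMap.map_update_neg, MultilinearMap.map_update_add,
    Finset.sum_neg_distrib, Finset.sum_add_distrib, map_neg] at hmain hcomm ⊢
  rw [← hcomm, ← sub_eq_zero] at hmain
  rw [← sub_eq_zero, ← hmain]
  abel
end

section
/- Let (𝔡, 𝔤) be a Lie pair of Lie algebras with a fixed linear splitting (j, p), ∇ : 𝔡 → End(B) an extension of the quotient 𝔤-action on B, and R₂, R₃ the associated higher Atiyah maps. Then for all a₁, a₂ ∈ 𝔤 and b₀, b₁, b₂ ∈ B: −(∂R₃)(a₁, a₂; b₀, b₁, b₂) = [R^∇(a₁; b₀)(R^∇(a₂; b₁)(b₂)) − R^∇(a₂; b₀)(R^∇(a₁; b₁)(b₂))] + [R^∇(a₁; R^∇(a₂; b₀)(b₁))(b₂) − R^∇(a₂; R^∇(a₁; b₀)(b₁))(b₂)] + [R^∇(a₁; b₁)(R^∇(a₂; b₀)(b₂)) − R^∇(a₂; b₁)(R^∇(a₁; b₀)(b₂))], where (∂R₃)(a₁, a₂; b₀, b₁,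 b₂) = a₁·(R₃(b₀, b₁, b₂)(a₂)) − R₃(a₁·b₀, b₁, b₂)(a₂) − R₃(b₀, a₁·b₁, b₂)(a₂) − R₃(b₀, b₁, a₁·b₂)(a₂) − a₂·(R₃(b₀, b₁, b₂)(a₁)) + R₃(a₂·b₀, b₁, b₂)(a₁) + R₃(b₀, a₂·b₁, b₂)(a₁) + R₃(b₀, b₁, a₂·b₂)(a₁) − R₃(b₀, b₁, b₂)([a₁, a₂]). (This is the Jacobi identity for the Atiyah cocycle, holding up to the Chevalley–Eilenberg coboundary of R₃.) -/
section

variable {k : Type*} [Field k] {d : Type*} [LieRing d] [LieAlgebra k d]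
  (g : LieSubalgebra k d)
  (jmap : (d ⧸ g.toSubmodule) →ₗ[k] d) (pmap : d →ₗ[k] g)
  (nab : d →ₗ[k] Module.End k (d ⧸ g.toSubmodule))

theorem hR_two_eq_atiyahB (b : Fin 2 → d ⧸ g.toSubmodule) (a : g) :
    hR g nab jmap pmap 2 b a = atiyahB g nab jmap a (b 0) (b 1) := by
  simp [hR, atiyahB]

theorem hR_three_eq (b₀ b₁ b₂ : d ⧸ g.toSubmodule) (a : g) :
    hR g nab jmap pmap 3 ![b₀, b₁, b₂] a =
      atiyahB g nab jmap a (nab (jmap b₀) b₁) b₂ + atiyahB g nab jmap a b₁ (nab (jmap b₀) b₂)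
        + atiyahB g nab jmap (pmap ⁅jmap b₀, (a : d)⁆) b₁ b₂
        - nab (jmap b₀) (atiyahB g nab jmap a b₁ b₂) := by
  rw [hR]
  simp [hR_two_eq_atiyahB, Fin.sum_univ_two]

theorem atiyahB_add_right (a : g) (b c : d ⧸ g.toSubmodule) :
    atiyahB g nab jmap a (b + c) = atiyahB g nab jmap a b + atiyahB g nab jmap a c := by
  ext x
  simp only [atiyahB, map_add, lie_add, LinearMap.sub_apply, LinearMap.add_apply,
    LinearMap.comp_apply]
  abel

theorem atiyahB_add_left (a a' : g) (b : d ⧸ g.toSubmodule) :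
    atiyahB g nab jmap (a + a') b = atiyahB g nab jmap a b + atiyahB g nab jmap a' b := by
  ext x
  simp only [atiyahB, map_add, AddMemClass.coe_add, add_lie, LinearMap.sub_apply,
    LinearMap.add_apply, LinearMap.comp_apply]
  abel

theorem atiyahB_sub_right (a : g) (b c : d ⧸ g.toSubmodule) :
    atiyahB g nab jmap a (b - c) = atiyahB g nab jmap a b - atiyahB g nab jmap a c := by
  rw [eq_sub_iff_add_eq, ← atiyahB_add_right, sub_add_cancel]

theorem atiyahB_sub_left (a a' : g) (b : d ⧸ g.toSubmodule) :
    atiyahB g nab jmap (a - a') b = atiyahB g nab jmap a b - atiyahB g nab jmap a' b := by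
  rw [eq_sub_iff_add_eq, ← atiyahB_add_left, sub_add_cancel]

variable {g jmap pmap nab}

theorem lie_splitting_eq (hj : ∀ b : d ⧸ g.toSubmodule, g.toSubmodule.mkQ (jmap b) = b)
    (hjp : ∀ l : d, jmap (g.toSubmodule.mkQ l) + ((pmap l : g) : d) = l)
    (a : g) (b : d ⧸ g.toSubmodule) :
    ⁅(a : d), jmap b⁆ = jmap (qact g a b) - ((pmap ⁅jmap b, (a : d)⁆ : g) : d) := by
  have hq : qact g a b = g.toSubmodule.mkQ ⁅(a : d), jmap b⁆ := by
    conv_lhs => rw [← hj b]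
    rfl
  have h := hjp ⁅(a : d), jmap b⁆
  have hskew : pmap ⁅jmap b, (a : d)⁆ = -pmap ⁅(a : d), jmap b⁆ := by
    rw [← map_neg, lie_skew]
  rw [hq, hskew, NegMemClass.coe_neg, sub_neg_eq_add, h]

/-- Commutation of `∇_a` with `∇_{j(b)}`, for `a ∈ 𝔤`. -/
theorem nab_comm (hj : ∀ b : d ⧸ g.toSubmodule, g.toSubmodule.mkQ (jmap b) = b)
    (hjp : ∀ l : d, jmap (g.toSubmodule.mkQ l) + ((pmap l : g) : d) = l)
    (hext : ∀ (a : g) (b : d ⧸ g.toSubmodule), nab (a : d) b = qact g a b)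
    (a : g) (b c : d ⧸ g.toSubmodule) :
    nab (jmap b) (qact g a c) =
      qact g a (nab (jmap b) c) - atiyahB g nab jmap a b c - nab (jmap (qact g a b)) c
        + qact g (pmap ⁅jmap b, (a : d)⁆) c := by
  simp only [atiyahB, lie_splitting_eq hj hjp, map_sub, LinearMap.sub_apply,
    LinearMap.comp_apply, hext]
  abel

theorem qact_add_left (a₁ a₂ : g) (b : d ⧸ g.toSubmodule) :
    qact g (a₁ + a₂) b = qact g a₁ b + qact g a₂ b := by
  obtain ⟨l, rfl⟩ := g.toSubmodule.mkQ_surjective b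
  simp only [qact, Submodule.mkQ_apply, Submodule.mapQ_apply, LieAlgebra.ad_apply,
    AddMemClass.coe_add, add_lie, Submodule.Quotient.mk_add]

theorem qact_sub_left (a₁ a₂ : g) (b : d ⧸ g.toSubmodule) :
    qact g (a₁ - a₂) b = qact g a₁ b - qact g a₂ b := by
  rw [eq_sub_iff_add_eq, ← qact_add_left, sub_add_cancel]

theorem qact_lie (a₁ a₂ : g) (b : d ⧸ g.toSubmodule) :
    qact g ⁅a₁, a₂⁆ b = qact g a₁ (qact g a₂ b) - qact g a₂ (qact g a₁ b) := by
  obtain ⟨l, rfl⟩ := g.toSubmodule.mkQ_surjective b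
  simp only [qact, Submodule.mkQ_apply, Submodule.mapQ_apply, LieAlgebra.ad_apply,
    LieSubalgebra.coe_bracket, lie_lie, Submodule.Quotient.mk_sub]

/-- The failure of `δ_b = p ⁅j(b), ·⁆` to be a derivation of `𝔤`. -/
theorem pmap_lie_splitting_lie (hj : ∀ b : d ⧸ g.toSubmodule, g.toSubmodule.mkQ (jmap b) = b)
    (hp : ∀ a : g, pmap (a : d) = a)
    (hjp : ∀ l : d, jmap (g.toSubmodule.mkQ l) + ((pmap l : g) : d) = l)
    (a₁ a₂ : g) (b : d ⧸ g.toSubmodule) :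
    pmap ⁅jmap b, ((⁅a₁, a₂⁆ : g) : d)⁆ =
      ⁅pmap ⁅jmap b, (a₁ : d)⁆, a₂⁆ + ⁅a₁, pmap ⁅jmap b, (a₂ : d)⁆⁆
        - pmap ⁅jmap (qact g a₁ b), (a₂ : d)⁆ + pmap ⁅jmap (qact g a₂ b), (a₁ : d)⁆ := by
  have h : ⁅jmap b, ((⁅a₁, a₂⁆ : g) : d)⁆ =
      ((⁅pmap ⁅jmap b, (a₁ : d)⁆, a₂⁆ + ⁅a₁, pmap ⁅jmap b, (a₂ : d)⁆⁆ : g) : d)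
        - ⁅jmap (qact g a₁ b), (a₂ : d)⁆ + ⁅jmap (qact g a₂ b), (a₁ : d)⁆ := by
    have h₁ (a : g) : ((pmap ⁅jmap b, (a : d)⁆ : g) : d) =
        jmap (qact g a b) + ⁅jmap b, (a : d)⁆ := by
      have h := eq_sub_iff_add_eq.mp (lie_splitting_eq hj hjp a b)
      rw [← lie_skew, neg_add_eq_iff_eq_add] at h
      rw [h, add_comm]
    simp only [AddMemClass.coe_add, LieSubalgebra.coe_bracket, h₁, add_lie, lie_add]
    rw [leibniz_lie, ← lie_skew (a₁ : d) (jmap (qact g a₂ b))]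
    abel
  rw [h, map_add, map_sub, hp]

/-- The Atiyah cocycle is closed for the Chevalley-Eilenberg differential. -/
theorem atiyahB_lie (hj : ∀ b : d ⧸ g.toSubmodule, g.toSubmodule.mkQ (jmap b) = b)
    (hp : ∀ a : g, pmap (a : d) = a)
    (hjp : ∀ l : d, jmap (g.toSubmodule.mkQ l) + ((pmap l : g) : d) = l)
    (hext : ∀ (a : g) (b : d ⧸ g.toSubmodule), nab (a : d) b = qact g a b)
    (a₁ a₂ : g) (b c : d ⧸ g.toSubmodule) :
    atiyahB g nab jmap ⁅a₁, a₂⁆ b c =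
      qact g a₁ (atiyahB g nab jmap a₂ b c) - atiyahB g nab jmap a₂ b (qact g a₁ c)
        - atiyahB g nab jmap a₂ (qact g a₁ b) c
        - qact g a₂ (atiyahB g nab jmap a₁ b c) + atiyahB g nab jmap a₁ b (qact g a₂ c)
        + atiyahB g nab jmap a₁ (qact g a₂ b) c := by
  simp only [atiyahB, lie_splitting_eq hj hjp, pmap_lie_splitting_lie hj hp hjp, map_sub,
    LinearMap.sub_apply, LinearMap.comp_apply, hext, qact_lie, qact_add_left, qact_sub_left]
  abel

end

/-- The Jacobi identity for the Atiyah cocycle holds up to the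
Chevalley–Eilenberg coboundary of `R₃`:
`−(∂R₃)(a₁,a₂;b₀,b₁,b₂) = [R^∇(a₁;b₀)(R^∇(a₂;b₁)(b₂)) − R^∇(a₂;b₀)(R^∇(a₁;b₁)(b₂))]
 + [R^∇(a₁;R^∇(a₂;b₀)(b₁))(b₂) − R^∇(a₂;R^∇(a₁;b₀)(b₁))(b₂)]
 + [R^∇(a₁;b₁)(R^∇(a₂;b₀)(b₂)) − R^∇(a₂;b₁)(R^∇(a₁;b₀)(b₂))]`. -/
theorem atiyah_stmt16 (k : Type*) [Field k] (d : Type*) [LieRing d] [LieAlgebra k d]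
    (g : LieSubalgebra k d)
    (jmap : (d ⧸ g.toSubmodule) →ₗ[k] d) (pmap : d →ₗ[k] g)
    (hj : ∀ b : d ⧸ g.toSubmodule, g.toSubmodule.mkQ (jmap b) = b)
    (hp : ∀ a : g, pmap (a : d) = a)
    (hjp : ∀ l : d, jmap (g.toSubmodule.mkQ l) + ((pmap l : g) : d) = l)
    (nab : d →ₗ[k] Module.End k (d ⧸ g.toSubmodule))
    (hext : ∀ (a : g) (b : d ⧸ g.toSubmodule), nab (a : d) b = qact g a b) :
    ∀ (a₁ a₂ : g) (b₀ b₁ b₂ : d ⧸ g.toSubmodule),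
      -(qact g a₁ (hR g nab jmap pmap 3 ![b₀, b₁, b₂] a₂)
          - hR g nab jmap pmap 3 ![qact g a₁ b₀, b₁, b₂] a₂
          - hR g nab jmap pmap 3 ![b₀, qact g a₁ b₁, b₂] a₂
          - hR g nab jmap pmap 3 ![b₀, b₁, qact g a₁ b₂] a₂
          - qact g a₂ (hR g nab jmap pmap 3 ![b₀, b₁, b₂] a₁)
          + hR g nab jmap pmap 3 ![qact g a₂ b₀, b₁, b₂] a₁
          + hR g nab jmap pmap 3 ![b₀, qact g a₂ b₁, b₂] a₁
          + hR g nab jmap pmap 3 ![b₀, b₁, qact g a₂ b₂] a₁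
          - hR g nab jmap pmap 3 ![b₀, b₁, b₂] ⁅a₁, a₂⁆)
        = (atiyahB g nab jmap a₁ b₀ (atiyahB g nab jmap a₂ b₁ b₂)
            - atiyahB g nab jmap a₂ b₀ (atiyahB g nab jmap a₁ b₁ b₂))
          + (atiyahB g nab jmap a₁ (atiyahB g nab jmap a₂ b₀ b₁) b₂
            - atiyahB g nab jmap a₂ (atiyahB g nab jmap a₁ b₀ b₁) b₂)
          + (atiyahB g nab jmap a₁ b₁ (atiyahB g nab jmap a₂ b₀ b₂)
            - atiyahB g nab jmap a₂ b₁ (atiyahB g nab jmap a₁ b₀ b₂)) := by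
  intro a₁ a₂ b₀ b₁ b₂
  have comm := nab_comm hj hjp hext
  have cocycle := atiyahB_lie hj hp hjp hext
  simp only [hR_three_eq, pmap_lie_splitting_lie hj hp hjp, comm, cocycle, map_sub, map_add,
    atiyahB_add_left, atiyahB_sub_left, atiyahB_add_right, atiyahB_sub_right,
    LinearMap.add_apply, LinearMap.sub_apply]
  abel
end

section
/- Let (𝔤, 𝔥) be a matched pair of Lie algebras over a field k and let γ : 𝔥 × 𝔥 → 𝔥 be a bilinear map that is flat, γ(x, γ(y, z)) − γ(y, γ(x, z)) = γ([x, y], z), and torsion free, γ(x, y) − γ(y, x) = [x, y], for all x, y, z ∈ 𝔥. Form the Lie algebra 𝔡 = 𝔤 ⋈ 𝔥 on 𝔤 ⊕ 𝔥, with Lie subalgebra 𝔤 = 𝔤 ⊕ 0, identify B = 𝔡/𝔤 with 𝔥 (so the quotient 𝔤-action on B is the matched-pair action a·y), take the splitting j(y) = (0, y), p(a, y) = a, and take the extension ∇ : 𝔡 → End(𝔥) given by ∇_{(a, x)}(y) = a·y + γ(x, y). Then every higher Atiyah map R_n (n ≥ 2) built from these data is totally symmetric: R_n(y_{σ(1)},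 …, y_{σ(n)}) = R_n(y₁, …, y_n) for every permutation σ of {1, …, n} and all y₁, …, y_n ∈ 𝔥. -/
/-- The higher Atiyah maps of the Lie pair `(𝔤 ⋈ 𝔥, 𝔤)` associated to a matched pair
`(𝔤, 𝔥)` of Lie algebras, written out explicitly.  Here `B = (𝔤 ⋈ 𝔥)/𝔤` is identified
with `𝔥`, the splitting is `j(y) = (0, y)`, `p(a, y) = a`, the extension of the quotient
`𝔤`-action is `∇_{(a,x)}(y) = a·y + γ(x, y)`, so that `δ_y = Δ_y`, `∇_{j(y₀)} = γ(y₀, ·)`,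
and the Atiyah cocycle is
`R^∇(a; y₁)(y₂) = a·γ(y₁,y₂) − γ(y₁, a·y₂) + (Δ_{y₁}a)·y₂ − γ(a·y₁, y₂)`
(using `⁅(a,0), (0,y₁)⁆ = (−Δ_{y₁}a, a·y₁)` in `𝔤 ⋈ 𝔥`).  The recursion is
`R_{n+1}(y₀,…,y_n)(a) = Σ_j R_n(y₁,…,γ(y₀,y_j),…,y_n)(a) + R_n(y₁,…,y_n)(Δ_{y₀}a)
  − γ(y₀, R_n(y₁,…,y_n)(a))`. -/
def Rmp {k : Type*} [Field k] {g : Type*} [LieRing g] [LieAlgebra k g]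
    {h : Type*} [LieRing h] [LieAlgebra k h]
    (act : g →ₗ[k] h →ₗ[k] h) (Δ : h →ₗ[k] g →ₗ[k] g) (γ : h →ₗ[k] h →ₗ[k] h) :
    (n : ℕ) → (Fin n → h) → g → h
  | 0, _, _ => 0
  | 1, _, _ => 0
  | 2, b, a =>
      act a (γ (b 0) (b 1)) - γ (b 0) (act a (b 1))
        + act (Δ (b 0) a) (b 1) - γ (act a (b 0)) (b 1)
  | (n+3), b, a =>
      (∑ i : Fin (n+2), Rmp act Δ γ (n+2)
          (Function.update (fun m : Fin (n+2) => b m.succ) i (γ (b 0) (b i.succ))) a)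
      + Rmp act Δ γ (n+2) (fun m => b m.succ) (Δ (b 0) a)
      - γ (b 0) (Rmp act Δ γ (n+2) (fun m => b m.succ) a)

section AtiyahMultilinear

variable {k : Type*} [Field k] {g : Type*} [LieRing g] [LieAlgebra k g]
  {h : Type*} [LieRing h] [LieAlgebra k h]
  {ι : Type*} [Fintype ι] [DecidableEq ι]

/-- Minus the covariant derivative on multilinear maps `hᶥ → Hom(g, h)` induced by `γ` on `h`
and `Δ` on `g`. -/
def negCovDeriv (Δ : h →ₗ[k] g →ₗ[k] g) (γ : h →ₗ[k] h →ₗ[k] h) (x : h)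
    (T : MultilinearMap k (fun _ : ι => h) (g →ₗ[k] h)) :
    MultilinearMap k (fun _ : ι => h) (g →ₗ[k] h) :=
  (∑ i, T.compLinearMap (Function.update (fun _ => LinearMap.id) i (γ x)))
    + (LinearMap.lcomp k h (Δ x)).compMultilinearMap T
    - (LinearMap.compRight k (γ x)).compMultilinearMap T

theorem negCovDeriv_apply (Δ : h →ₗ[k] g →ₗ[k] g) (γ : h →ₗ[k] h →ₗ[k] h) (x : h)
    (T : MultilinearMap k (fun _ : ι => h) (g →ₗ[k] h)) (z : ι → h) (a : g) :
    negCovDeriv Δ γ x T z a =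
      (∑ i, T (Function.update z i (γ x (z i))) a) + T z (Δ x a) - γ x (T z a) := by
  have key (i : ι) :
      (fun j => (Function.update (fun _ => LinearMap.id) i (γ x) : ι → h →ₗ[k] h) j (z j))
        = Function.update z i (γ x (z i)) := by
    ext j
    rcases eq_or_ne j i with rfl | hj
    · simp
    · simp [hj]
  simp [negCovDeriv, key]

/-- `negCovDeriv` as a linear map in the direction of differentiation. -/
def negCovDerivLinear (Δ : h →ₗ[k] g →ₗ[k] g) (γ : h →ₗ[k] h →ₗ[k] h)
    (T : MultilinearMap k (fun _ : ι => h) (g →ₗ[k] h)) :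
    h →ₗ[k] MultilinearMap k (fun _ : ι => h) (g →ₗ[k] h) where
  toFun x := negCovDeriv Δ γ x T
  map_add' x y := by
    ext z a
    simp only [negCovDeriv_apply, add_apply, LinearMap.add_apply, map_add,
      MultilinearMap.map_update_add, Finset.sum_add_distrib]
    abel
  map_smul' c x := by
    ext z a
    simp only [negCovDeriv_apply, smul_apply, LinearMap.smul_apply, map_smul,
      MultilinearMap.map_update_smul, RingHom.id_apply, ← Finset.smul_sum]
    module

theorem negCovDerivLinear_apply (Δ : h →ₗ[k] g →ₗ[k] g) (γ : h →ₗ[k] h →ₗ[k] h)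
    (T : MultilinearMap k (fun _ : ι => h) (g →ₗ[k] h)) (x : h) :
    negCovDerivLinear Δ γ T x = negCovDeriv Δ γ x T := rfl

/-- Two slotwise actions on a multilinear map commute up to the slotwise action of the
commutator. -/
theorem MultilinearMap.sum_update_comm {N : Type*} [AddCommGroup N] [Module k N]
    (T : MultilinearMap k (fun _ : ι => h) N) (p q : h →ₗ[k] h) (z : ι → h) :
    (∑ i, ∑ j, T (Function.update (Function.update z i (p (z i))) j
        (q (Function.update z i (p (z i)) j))))
      - ∑ i, ∑ j, T (Function.update (Function.update z i (q (z i))) j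
        (p (Function.update z i (q (z i)) j)))
      = ∑ i, T (Function.update z i (q (p (z i)) - p (q (z i)))) := by
  rw [Finset.sum_comm (γ := ι), ← Finset.sum_sub_distrib]
  refine Finset.sum_congr rfl fun i _ => ?_
  rw [← Finset.sum_sub_distrib, Finset.sum_eq_single i]
  · simp [MultilinearMap.map_update_sub]
  · intro j _ hj
    rw [Function.update_of_ne hj.symm, Function.update_of_ne hj,
      Function.update_comm hj, sub_self]
  · simp

/-- For a flat connection `γ` and a representation `Δ`, the covariant derivative is flat. -/
theorem negCovDeriv_comm (Δ : h →ₗ[k] g →ₗ[k] g) (γ : h →ₗ[k] h →ₗ[k] h)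
    (hΔ : ∀ (y₁ y₂ : h) (a : g), Δ ⁅y₁, y₂⁆ a = Δ y₁ (Δ y₂ a) - Δ y₂ (Δ y₁ a))
    (hflat : ∀ x y z : h, γ x (γ y z) - γ y (γ x z) = γ ⁅x, y⁆ z) (x y : h)
    (T : MultilinearMap k (fun _ : ι => h) (g →ₗ[k] h)) :
    negCovDeriv Δ γ x (negCovDeriv Δ γ y T) - negCovDeriv Δ γ y (negCovDeriv Δ γ x T)
      = - negCovDeriv Δ γ ⁅x, y⁆ T := by
  ext z a
  have hsum := congrArg (fun f : g →ₗ[k] h => f a) (T.sum_update_comm (γ y) (γ x) z)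
  simp only [LinearMap.sub_apply, LinearMap.sum_apply, hflat] at hsum
  simp only [sub_apply, LinearMap.sub_apply, neg_apply,
    LinearMap.neg_apply, negCovDeriv_apply, Finset.sum_add_distrib, Finset.sum_sub_distrib,
    map_add, map_sub, map_sum, hΔ]
  rw [← hsum, ← hflat]
  abel

/-- The covariant derivative of a symmetric multilinear map is symmetric. -/
theorem negCovDeriv_comp_perm (Δ : h →ₗ[k] g →ₗ[k] g) (γ : h →ₗ[k] h →ₗ[k] h) (x : h)
    (T : MultilinearMap k (fun _ : ι => h) (g →ₗ[k] h))
    (σ : Equiv.Perm ι) (hT : ∀ z : ι → h, T (z ∘ σ) = T z) (z : ι → h) :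
    negCovDeriv Δ γ x T (z ∘ σ) = negCovDeriv Δ γ x T z := by
  ext a
  rw [negCovDeriv_apply, negCovDeriv_apply, hT]
  congr 2
  refine Fintype.sum_equiv σ _ _ fun i => ?_
  rw [← hT (Function.update z (σ i) _), Function.update_comp_equiv, Equiv.symm_apply_apply,
    Function.comp_apply]

/-- The higher Atiyah map in `n + 2` arguments, as a multilinear map. -/
def atiyahMultilinear (act : g →ₗ[k] h →ₗ[k] h) (Δ : h →ₗ[k] g →ₗ[k] g)
    (γ : h →ₗ[k] h →ₗ[k] h) :
    (n : ℕ) → MultilinearMap k (fun _ : Fin (n + 2) => h) (g →ₗ[k] h)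
  | 0 => LinearMap.uncurryLeft
      (negCovDerivLinear Δ γ (MultilinearMap.ofSubsingletonₗ k k h (g →ₗ[k] h) 0 act.flip)
        - (MultilinearMap.ofSubsingletonₗ k k h (g →ₗ[k] h) (0 : Fin 1)).toLinearMap ∘ₗ
          (LinearMap.lflip.toLinearMap ∘ₗ (LinearMap.llcomp k g h (h →ₗ[k] h) γ) ∘ₗ act.flip))
  | n + 1 => LinearMap.uncurryLeft (negCovDerivLinear Δ γ (atiyahMultilinear act Δ γ n))

variable (act : g →ₗ[k] h →ₗ[k] h) (Δ : h →ₗ[k] g →ₗ[k] g) (γ : h →ₗ[k] h →ₗ[k] h)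

theorem atiyahMultilinear_zero_apply (y : Fin 2 → h) (a : g) :
    atiyahMultilinear act Δ γ 0 y a =
      act a (γ (y 0) (y 1)) - γ (y 0) (act a (y 1))
        + act (Δ (y 0) a) (y 1) - γ (act a (y 0)) (y 1) := by
  simp only [atiyahMultilinear, LinearMap.uncurryLeft_apply, LinearMap.sub_apply,
    sub_apply, negCovDerivLinear_apply, negCovDeriv_apply]
  simp [MultilinearMap.ofSubsingletonₗ, MultilinearMap.ofSubsingleton, Fin.tail]
  abel

theorem atiyahMultilinear_succ_apply (n : ℕ) (y : Fin (n + 3) → h) :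
    atiyahMultilinear act Δ γ (n + 1) y =
      negCovDeriv Δ γ (y 0) (atiyahMultilinear act Δ γ n) (Fin.tail y) := rfl

theorem Rmp_eq_atiyahMultilinear (n : ℕ) (y : Fin (n + 2) → h) (a : g) :
    Rmp act Δ γ (n + 2) y a = atiyahMultilinear act Δ γ n y a := by
  induction n generalizing a with
  | zero => rw [atiyahMultilinear_zero_apply]; rfl
  | succ n ih =>
    rw [atiyahMultilinear_succ_apply, negCovDeriv_apply, Rmp]
    simp only [ih]
    rfl

variable {act Δ γ}

theorem atiyahMultilinear_zero_swap
    (hc : ∀ (a : g) (y₁ y₂ : h),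
      act a ⁅y₁, y₂⁆ = ⁅act a y₁, y₂⁆ + ⁅y₁, act a y₂⁆ + act (Δ y₂ a) y₁ - act (Δ y₁ a) y₂)
    (htf : ∀ x y : h, γ x y - γ y x = ⁅x, y⁆) (y : Fin 2 → h) :
    atiyahMultilinear act Δ γ 0 (y ∘ Equiv.swap 0 1) = atiyahMultilinear act Δ γ 0 y := by
  ext a
  have hc' := hc a (y 0) (y 1)
  simp only [← htf, map_sub] at hc'
  simp only [atiyahMultilinear_zero_apply, Function.comp_apply, Equiv.swap_apply_left,
    Equiv.swap_apply_right]
  linear_combination (norm := module) -hc'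

theorem atiyahMultilinear_one_swap
    (hΔ : ∀ (y₁ y₂ : h) (a : g), Δ ⁅y₁, y₂⁆ a = Δ y₁ (Δ y₂ a) - Δ y₂ (Δ y₁ a))
    (hc : ∀ (a : g) (y₁ y₂ : h),
      act a ⁅y₁, y₂⁆ = ⁅act a y₁, y₂⁆ + ⁅y₁, act a y₂⁆ + act (Δ y₂ a) y₁ - act (Δ y₁ a) y₂)
    (hflat : ∀ x y z : h, γ x (γ y z) - γ y (γ x z) = γ ⁅x, y⁆ z)
    (htf : ∀ x y : h, γ x y - γ y x = ⁅x, y⁆) (y : Fin 3 → h) :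
    atiyahMultilinear act Δ γ 1 (y ∘ Equiv.swap 0 1) = atiyahMultilinear act Δ γ 1 y := by
  ext a
  have expand (w : Fin 3 → h) : atiyahMultilinear act Δ γ 1 w a =
      atiyahMultilinear act Δ γ 0 ![γ (w 0) (w 1), w 2] a
        + atiyahMultilinear act Δ γ 0 ![w 1, γ (w 0) (w 2)] a
        + atiyahMultilinear act Δ γ 0 ![w 1, w 2] (Δ (w 0) a)
        - γ (w 0) (atiyahMultilinear act Δ γ 0 ![w 1, w 2] a) := by
    have ht : Fin.tail w = ![w 1, w 2] := by ext i; fin_cases i <;> rfl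
    rw [atiyahMultilinear_succ_apply, negCovDeriv_apply, ht, Fin.sum_univ_two]
    congr 4
  have h2 : Equiv.swap (0 : Fin 3) 1 2 = 2 := by decide
  rw [expand, expand]
  simp only [Function.comp_apply, Equiv.swap_apply_left, Equiv.swap_apply_right, h2]
  generalize y 0 = u
  generalize y 1 = v
  generalize y 2 = w
  have hflat' (x y z : h) : γ x (γ y z) - γ y (γ x z) = γ (γ x y) z - γ (γ y x) z := by
    rw [hflat, ← htf, map_sub, LinearMap.sub_apply]
  have e1 := congrArg (act a) (hflat' u v w)
  have e2 := hflat' u v (act a w)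
  have e3 := congrArg (fun b => act b w) (hΔ u v a)
  have e4 := hflat' (act a v) u w
  have e5 := hflat' (act a u) v w
  have e6 := congrArg (fun b => γ b w) (hc a u v)
  simp only [← htf, map_sub, map_add, LinearMap.sub_apply, LinearMap.add_apply] at e1 e3 e6
  simp only [atiyahMultilinear_zero_apply, Matrix.cons_val_zero, Matrix.cons_val_one, map_sub,
    map_add]
  linear_combination (norm := module) e1 - e2 - e3 + e4 - e5 + e6

theorem atiyahMultilinear_add_two_swap
    (hΔ : ∀ (y₁ y₂ : h) (a : g), Δ ⁅y₁, y₂⁆ a = Δ y₁ (Δ y₂ a) - Δ y₂ (Δ y₁ a))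
    (hflat : ∀ x y z : h, γ x (γ y z) - γ y (γ x z) = γ ⁅x, y⁆ z)
    (htf : ∀ x y : h, γ x y - γ y x = ⁅x, y⁆) (n : ℕ) (y : Fin (n + 4) → h) :
    atiyahMultilinear act Δ γ (n + 2) (y ∘ Equiv.swap 0 1)
      = atiyahMultilinear act Δ γ (n + 2) y := by
  have expand (w : Fin (n + 4) → h) : atiyahMultilinear act Δ γ (n + 2) w =
      negCovDeriv Δ γ (γ (w 0) (w 1)) (atiyahMultilinear act Δ γ n) (Fin.tail (Fin.tail w))
        + negCovDeriv Δ γ (w 0) (negCovDeriv Δ γ (w 1) (atiyahMultilinear act Δ γ n))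
          (Fin.tail (Fin.tail w)) := by
    ext a
    rw [atiyahMultilinear_succ_apply, negCovDeriv_apply, Fin.sum_univ_succ]
    simp only [atiyahMultilinear_succ_apply, Fin.tail_update_zero, Fin.tail_update_succ,
      Function.update_self, LinearMap.add_apply,
      negCovDeriv_apply Δ γ (w 0) (negCovDeriv Δ γ (w 1) (atiyahMultilinear act Δ γ n)),
      Function.update_of_ne (Fin.succ_ne_zero _).symm]
    simp only [Fin.tail, Fin.succ_zero_eq_one]
    abel
  have ht : Fin.tail (Fin.tail (y ∘ Equiv.swap 0 1)) = Fin.tail (Fin.tail y) := by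
    ext i
    simp only [Fin.tail, Function.comp_apply]
    have h1 : i.succ.succ ≠ 1 := (Fin.succ_injective _).ne (Fin.succ_ne_zero i)
    rw [Equiv.swap_apply_of_ne_of_ne (Fin.succ_ne_zero _) h1]
  rw [expand, expand, ht]
  simp only [Function.comp_apply, Equiv.swap_apply_left, Equiv.swap_apply_right]
  have hcomm := congrArg (fun T => T (Fin.tail (Fin.tail y)))
    (negCovDeriv_comm Δ γ hΔ hflat (y 0) (y 1) (atiyahMultilinear act Δ γ n))
  have hlin := congrArg (fun T => T (Fin.tail (Fin.tail y)))
    ((negCovDerivLinear Δ γ (atiyahMultilinear act Δ γ n)).map_sub (γ (y 0) (y 1)) (γ (y 1) (y 0)))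
  simp only [negCovDerivLinear_apply, htf, sub_apply,
    neg_apply] at hcomm hlin
  linear_combination (norm := module) -hcomm + hlin

theorem atiyahMultilinear_comp_perm
    (hΔ : ∀ (y₁ y₂ : h) (a : g), Δ ⁅y₁, y₂⁆ a = Δ y₁ (Δ y₂ a) - Δ y₂ (Δ y₁ a))
    (hc : ∀ (a : g) (y₁ y₂ : h),
      act a ⁅y₁, y₂⁆ = ⁅act a y₁, y₂⁆ + ⁅y₁, act a y₂⁆ + act (Δ y₂ a) y₁ - act (Δ y₁ a) y₂)
    (hflat : ∀ x y z : h, γ x (γ y z) - γ y (γ x z) = γ ⁅x, y⁆ z)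
    (htf : ∀ x y : h, γ x y - γ y x = ⁅x, y⁆) (n : ℕ) (σ : Equiv.Perm (Fin (n + 2)))
    (y : Fin (n + 2) → h) :
    atiyahMultilinear act Δ γ n (y ∘ σ) = atiyahMultilinear act Δ γ n y := by
  induction n with
  | zero =>
    have hσ : σ = 1 ∨ σ = Equiv.swap 0 1 := by revert σ; decide
    rcases hσ with rfl | rfl
    · rfl
    · exact atiyahMultilinear_zero_swap hc htf y
  | succ n ih =>
    have hmem : σ ∈ Submonoid.closure
        (Set.range fun i : Fin (n + 2) => Equiv.swap i.castSucc i.succ) := by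
      rw [Equiv.Perm.mclosure_swap_castSucc_succ]; trivial
    induction hmem using Submonoid.closure_induction generalizing y with
    | one => rfl
    | mul σ τ _ _ hσ hτ => rw [Equiv.Perm.coe_mul, ← Function.comp_assoc, hτ, hσ]
    | mem σ hσ =>
      obtain ⟨i, rfl⟩ := hσ
      cases i using Fin.cases with
      | zero =>
        rcases n with _ | n
        · exact atiyahMultilinear_one_swap hΔ hc hflat htf y
        · exact atiyahMultilinear_add_two_swap hΔ hflat htf n y
      | succ i =>
        have ht : Fin.tail (y ∘ Equiv.swap i.succ.castSucc i.succ.succ)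
            = Fin.tail y ∘ Equiv.swap i.castSucc i.succ := by
          ext j
          simp only [Fin.tail, Function.comp_apply, ← Fin.succ_castSucc]
          rw [(Fin.succ_injective _).map_swap]
        have h0 : (y ∘ Equiv.swap i.succ.castSucc i.succ.succ) 0 = y 0 := by
          rw [Function.comp_apply, ← Fin.succ_castSucc, Equiv.swap_apply_of_ne_of_ne
            (Fin.succ_ne_zero _).symm (Fin.succ_ne_zero _).symm]
        simp only [atiyahMultilinear_succ_apply]
        rw [ht, h0]
        exact negCovDeriv_comp_perm Δ γ (y 0) _ _ (fun z => ih _ z) _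

end AtiyahMultilinear

/-- Let `(𝔤, 𝔥)` be a matched pair of Lie algebras and `γ` a flat,
torsion-free `𝔥`-connection on `𝔥`.  Then every higher Atiyah map `R_n` (`n ≥ 2`) built
from the Lie pair `(𝔤 ⋈ 𝔥, 𝔤)` with its canonical splitting and the extension
`∇_{(a,x)}(y) = a·y + γ(x,y)` is totally symmetric. -/
theorem atiyah_stmt18 (k : Type*) [Field k]
    (g : Type*) [LieRing g] [LieAlgebra k g]
    (h : Type*) [LieRing h] [LieAlgebra k h]
    (act : g →ₗ[k] h →ₗ[k] h) (Δ : h →ₗ[k] g →ₗ[k] g)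
    (hact : ∀ (a₁ a₂ : g) (y : h), act ⁅a₁, a₂⁆ y = act a₁ (act a₂ y) - act a₂ (act a₁ y))
    (hΔ : ∀ (y₁ y₂ : h) (a : g), Δ ⁅y₁, y₂⁆ a = Δ y₁ (Δ y₂ a) - Δ y₂ (Δ y₁ a))
    (hc1 : ∀ (a : g) (y₁ y₂ : h),
      act a ⁅y₁, y₂⁆ = ⁅act a y₁, y₂⁆ + ⁅y₁, act a y₂⁆ + act (Δ y₂ a) y₁ - act (Δ y₁ a) y₂)
    (hc2 : ∀ (y : h) (a₁ a₂ : g),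
      Δ y ⁅a₁, a₂⁆ = ⁅Δ y a₁, a₂⁆ + ⁅a₁, Δ y a₂⁆ + Δ (act a₂ y) a₁ - Δ (act a₁ y) a₂)
    (γ : h →ₗ[k] h →ₗ[k] h)
    (hflat : ∀ x y z : h, γ x (γ y z) - γ y (γ x z) = γ ⁅x, y⁆ z)
    (htf : ∀ x y : h, γ x y - γ y x = ⁅x, y⁆) :
    ∀ (n : ℕ), 2 ≤ n → ∀ (σ : Equiv.Perm (Fin n)) (y : Fin n → h) (a : g),
      Rmp act Δ γ n (fun i => y (σ i)) a = Rmp act Δ γ n y a := by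
  intro n hn σ y a
  obtain ⟨n, rfl⟩ := Nat.exists_eq_add_of_le' hn
  rw [Rmp_eq_atiyahMultilinear, Rmp_eq_atiyahMultilinear]
  exact congrArg (fun T : g →ₗ[k] h => T a)
    (atiyahMultilinear_comp_perm hΔ hc1 hflat htf n σ y)
end
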